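/- For every δ > 0 and ε > 0 there exists N such that for every natural number n > N with gcd(n, 6) = 1 the following holds: if the set F_n is partitioned into pairwise disjoint minimal invariant sets O_1, …, O_k, then the sum of the cardinalities of those O_i whose normalized counting measure is at Lévy–Prokhorov distance at least δ from the Haar measure λ is less than ε·n. -/

import Mathlib

open MeasureTheory

noncomputable section

/-- The circle `[0,1]` with endpoints identified. -/
abbrev 𝕋 := AddCircle (1 : ℝ)

instance : IsProbabilityMeasure (volume : Measure 𝕋) :=
  ⟨by simp [AddCircle.measure_univ]⟩

/-- The doubling map. -/
def T (x : 𝕋) : 𝕋 := 2 • x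

/-- The tripling map. -/
def S (x : 𝕋) : 𝕋 := 3 • x

/-- A set is invariant if it is forward invariant under both `T` and `S`. -/
def Invariant (O : Set 𝕋) : Prop := T '' O ⊆ O ∧ S '' O ⊆ O

/-- A nonempty finite invariant set is minimal if every nonempty invariant subset equals it. -/
def MinimalInvariant (O : Set 𝕋) : Prop :=
  O.Nonempty ∧ O.Finite ∧ Invariant O ∧
    ∀ O' ⊆ O, O'.Nonempty → Invariant O' → O' = O

/-- A measure is invariant if both `T` and `S` are measure preserving for it. -/
def InvariantMeasure (μ : Measure 𝕋) : Prop :=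
  MeasurePreserving T μ μ ∧ MeasurePreserving S μ μ

/-- The normalized counting measure on a set: each point of a finite set `O`
gets mass `1 / |O|`. -/
def normCount (O : Set 𝕋) : Measure 𝕋 :=
  (O.ncard : ENNReal)⁻¹ • Measure.count.restrict O

/-- `Fn n` is the set of points `i/n` of the circle with `0 < i < n`. -/
def Fn (n : ℕ) : Set 𝕋 := {x : 𝕋 | ∃ i : ℕ, 0 < i ∧ i < n ∧ x = ((i : ℝ) / n : ℝ)}

open Filter Topology

lemma integral_fourier_eq_zero {m : ℤ} (hm : m ≠ 0) :
    ∫ x : 𝕋, fourier m x = 0 :=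
  integral_eq_zero_of_add_right_eq_neg (μ := (volume : Measure 𝕋))
    (fourier_add_half_inv_index hm one_pos)

lemma integrable_continuousMap (μ : Measure 𝕋) [IsFiniteMeasure μ] (f : C(𝕋, ℂ)) :
    Integrable f μ :=
  (BoundedContinuousFunction.mkOfCompact f).integrable μ

/-- Haar measure on the circle, bundled as a probability measure. -/
def haarProbabilityMeasure : ProbabilityMeasure 𝕋 := ⟨volume, inferInstance⟩

/-- Weyl's criterion for probability measures on the circle. -/
lemma tendsto_volume_of_tendsto_integral_fourier (μ : ℕ → ProbabilityMeasure 𝕋)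
    (h : ∀ m : ℤ, m ≠ 0 → Tendsto (fun k => ∫ x, fourier m x ∂(μ k : Measure 𝕋)) atTop (𝓝 0)) :
    Tendsto μ atTop (𝓝 haarProbabilityMeasure) := by
  have key : ∀ g ∈ Submodule.span ℂ (Set.range (@fourier (1 : ℝ))),
      Tendsto (fun k => ∫ x, g x ∂(μ k : Measure 𝕋)) atTop (𝓝 (∫ x : 𝕋, g x)) := by
    intro g hg
    induction hg using Submodule.span_induction with
    | mem g hg =>
      obtain ⟨m, rfl⟩ := hg
      rcases eq_or_ne m 0 with rfl | hm
      · simp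
      · rw [integral_fourier_eq_zero hm]
        exact h m hm
    | zero => simp
    | add f g _ _ hf hg =>
      simp only [ContinuousMap.add_apply]
      rw [integral_add (integrable_continuousMap _ f) (integrable_continuousMap _ g)]
      simp_rw [fun k => integral_add (integrable_continuousMap (μ k : Measure 𝕋) f)
        (integrable_continuousMap _ g)]
      exact hf.add hg
    | smul c f _ hf =>
      simp only [ContinuousMap.smul_apply, integral_smul]
      exact hf.const_smul c
  have close (ν : Measure 𝕋) [IsProbabilityMeasure ν] (f g : C(𝕋, ℂ)) :
      ‖∫ x, f x ∂ν - ∫ x, g x ∂ν‖ ≤ ‖f - g‖ := by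
    rw [← integral_sub (integrable_continuousMap ν f) (integrable_continuousMap ν g)]
    simpa using norm_integral_le_of_norm_le_const (μ := ν)
      (Eventually.of_forall fun x => (f - g).norm_coe_le_norm x)
  rw [ProbabilityMeasure.tendsto_iff_forall_integral_rclike_tendsto ℂ]
  intro f
  have hf : f.toContinuousMap ∈ closure (Submodule.span ℂ (Set.range (@fourier (1 : ℝ))) :
      Set C(𝕋, ℂ)) := by
    rw [← Submodule.topologicalClosure_coe, span_fourier_closure_eq_top]
    trivial
  rw [Metric.tendsto_nhds]
  intro ε hε
  obtain ⟨g, hg, hfg⟩ := Metric.mem_closure_iff.1 hf (ε / 3) (by positivity)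
  rw [dist_eq_norm] at hfg
  filter_upwards [Metric.tendsto_nhds.1 (key g hg) (ε / 3) (by positivity)] with k hk
  have h₁ := close (μ k : Measure 𝕋) f.toContinuousMap g
  have h₂ := close (volume : Measure 𝕋) f.toContinuousMap g
  rw [← dist_eq_norm] at h₁ h₂
  rw [dist_comm] at h₂
  exact (dist_triangle4 _ _ _ _).trans_lt
    ((add_lt_add (add_lt_add (h₁.trans_lt hfg) hk) (h₂.trans_lt hfg)).trans_eq (by ring))

/-- A probability measure whose low nontrivial Fourier coefficients are small is
Lévy–Prokhorov close to Haar measure. -/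
lemma exists_levyProkhorovDist_lt_of_norm_integral_fourier_lt {δ : ℝ} (hδ : 0 < δ) :
    ∃ (M : ℕ) (η : ℝ), 0 < η ∧ ∀ μ : Measure 𝕋, IsProbabilityMeasure μ →
      (∀ m : ℤ, m ≠ 0 → |m| ≤ M → ‖∫ x, fourier m x ∂μ‖ < η) →
      levyProkhorovDist μ volume < δ := by
  by_contra! hcon
  choose μ hμ hsmall hfar using fun M : ℕ => hcon M (1 / ((M : ℝ) + 1)) (by positivity)
  let ν : ℕ → ProbabilityMeasure 𝕋 := fun M => ⟨μ M, hμ M⟩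
  have hlim : Tendsto ν atTop (𝓝 haarProbabilityMeasure) := by
    refine tendsto_volume_of_tendsto_integral_fourier _ fun m hm => ?_
    refine squeeze_zero_norm' ?_ tendsto_one_div_add_atTop_nhds_zero_nat
    filter_upwards [eventually_ge_atTop m.natAbs] with M hM
    exact (hsmall M m hm (by rw [Int.abs_eq_natAbs]; omega)).le
  have hLP := (LevyProkhorov.continuous_ofMeasure_probabilityMeasure.tendsto _).comp hlim
  obtain ⟨M, hM⟩ := (Metric.tendsto_nhds.1 hLP δ hδ).exists
  exact (hfar M).not_gt hM

lemma isProbabilityMeasure_normCount {O : Set 𝕋} (hO : O.Nonempty) (hfin : O.Finite) :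
    IsProbabilityMeasure (normCount O) := by
  constructor
  have h0 : O.ncard ≠ 0 := (Set.ncard_pos hfin).2 hO |>.ne'
  rw [normCount, Measure.smul_apply, Measure.restrict_apply_univ,
    Measure.count_apply_finite O hfin, ← Set.ncard_eq_toFinset_card O hfin, smul_eq_mul]
  exact ENNReal.inv_mul_cancel (by simpa using h0) (by simp)

lemma integral_normCount (s : Finset 𝕋) (f : C(𝕋, ℂ)) :
    ∫ x, f x ∂(normCount (s : Set 𝕋)) = (s.card : ℂ)⁻¹ * ∑ x ∈ s, f x := by
  rw [normCount, integral_smul_measure, setIntegral_finset]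
  · simp [Measure.real]
  · have : IsFiniteMeasure (Measure.count.restrict (s : Set 𝕋)) :=
      isFiniteMeasure_restrict.2 (by simp [Measure.count_apply_finset])
    exact integrable_continuousMap _ f

lemma fourier_nsmul (m : ℤ) (k : ℕ) (x : 𝕋) : fourier m (k • x) = fourier (m * k) x := by
  rw [fourier_apply, fourier_apply, mul_smul, natCast_zsmul]

lemma fourier_nsmul_eq_pow (m : ℤ) (k : ℕ) (x : 𝕋) : fourier m (k • x) = fourier m x ^ k := by
  induction k with
  | zero => simp
  | succ k ih =>
    rw [succ_nsmul, pow_succ, ← ih]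
    simp [fourier_apply, AddCircle.toCircle_add]

lemma sum_fourier_div_eq_zero {n : ℕ} {m : ℤ} (hn : n ≠ 0) (hm : ¬ (n : ℤ) ∣ m) :
    ∑ i ∈ Finset.range n, fourier m (((i : ℝ) / n : ℝ) : 𝕋) = 0 := by
  have hn' : (n : ℝ) ≠ 0 := by exact_mod_cast hn
  have hcoe (i : ℕ) : (((i : ℝ) / n : ℝ) : 𝕋) = i • (((1 : ℝ) / n : ℝ) : 𝕋) := by
    rw [← AddCircle.coe_nsmul, nsmul_eq_mul, mul_one_div]
  have hone : fourier m (((1 : ℝ) / n : ℝ) : 𝕋) ≠ 1 := by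
    rw [fourier_coe_apply, Ne, Complex.exp_eq_one_iff]
    rintro ⟨j, hj⟩
    refine hm ⟨j, ?_⟩
    have hnC : (n : ℂ) ≠ 0 := by exact_mod_cast hn
    have h2 := Complex.two_pi_I_ne_zero
    push_cast at hj
    field_simp at hj
    have : (m : ℂ) = n * j := by linear_combination hj
    exact_mod_cast this
  have hpow : fourier m (((1 : ℝ) / n : ℝ) : 𝕋) ^ n = 1 := by
    rw [← fourier_nsmul_eq_pow, ← hcoe, div_self hn', AddCircle.coe_period, fourier_eval_zero]
  simp_rw [hcoe, fourier_nsmul_eq_pow]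
  rw [geom_sum_eq hone, hpow, sub_self, zero_div]

lemma MinimalInvariant.image_T {O : Set 𝕋} (hO : MinimalInvariant O) : T '' O = O := by
  obtain ⟨hne, -, ⟨hT, hS⟩, hmin⟩ := hO
  refine hmin _ hT (hne.image T) ⟨Set.image_mono hT, ?_⟩
  rintro _ ⟨_, ⟨x, hx, rfl⟩, rfl⟩
  exact ⟨S x, hS ⟨x, hx, rfl⟩, smul_comm 2 3 x⟩

lemma sum_comp_T_of_image_eq {s : Finset 𝕋} (hs : T '' (s : Set 𝕋) = s) (f : 𝕋 → ℂ) :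
    ∑ x ∈ s, f (T x) = ∑ x ∈ s, f x := by
  classical
  have himg : s.image T = s := by
    rw [← Finset.coe_inj, Finset.coe_image, hs]
  have hinj : Set.InjOn T s := Finset.card_image_iff.1 (by rw [himg])
  conv_rhs => rw [← himg, Finset.sum_image hinj]

lemma sum_comp_pow_two_nsmul {s : Finset 𝕋} (hs : T '' (s : Set 𝕋) = s) (f : 𝕋 → ℂ) (j : ℕ) :
    ∑ x ∈ s, f (2 ^ j • x) = ∑ x ∈ s, f x := by
  induction j with
  | zero => simp
  | succ j ih =>
    rw [← ih, ← sum_comp_T_of_image_eq hs fun x => f (2 ^ j • x)]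
    simp only [T, smul_smul, pow_succ]

/-- The sum of a character along the first `L` points of a doubling orbit. -/
def doublingSum (m : ℤ) (L : ℕ) (x : 𝕋) : ℂ := ∑ j ∈ Finset.range L, fourier m (2 ^ j • x)

lemma sum_doublingSum {s : Finset 𝕋} (hs : T '' (s : Set 𝕋) = s) (m : ℤ) (L : ℕ) :
    ∑ x ∈ s, doublingSum m L x = L * ∑ x ∈ s, fourier m x := by
  simp only [doublingSum]
  rw [Finset.sum_comm]
  simp_rw [fun j => sum_comp_pow_two_nsmul hs (fun x => fourier m x) j]
  simp

lemma card_mul_le_sum_norm_doublingSum_sq {s : Finset 𝕋} (hs : T '' (s : Set 𝕋) = s)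
    (hne : s.Nonempty) (m : ℤ) (L : ℕ) {η : ℝ} (hη : 0 ≤ η)
    (hfar : η ≤ ‖∫ x, fourier m x ∂(normCount (s : Set 𝕋))‖) :
    (s.card : ℝ) * (L * η) ^ 2 ≤ ∑ x ∈ s, ‖doublingSum m L x‖ ^ 2 := by
  have hcard : (0 : ℝ) < s.card := by exact_mod_cast hne.card_pos
  have hsum : s.card * η ≤ ‖∑ x ∈ s, fourier m x‖ := by
    rw [integral_normCount, norm_mul, norm_inv, Complex.norm_natCast, inv_mul_eq_div,
      le_div_iff₀ hcard] at hfar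
    linarith
  have hL : s.card * (L * η) ≤ ∑ x ∈ s, ‖doublingSum m L x‖ := by
    refine le_trans ?_ (norm_sum_le _ _)
    rw [sum_doublingSum hs, norm_mul, Complex.norm_natCast]
    calc s.card * (L * η) = L * (s.card * η) := by ring
      _ ≤ _ := by gcongr
  have hsq := (pow_le_pow_left₀ (by positivity) hL 2).trans sq_sum_le_card_mul_sum_sq
  refine le_of_mul_le_mul_left (le_trans (le_of_eq ?_) hsq) hcard
  ring

lemma sum_norm_doublingSum_sq {n L : ℕ} {m : ℤ} (hm : m ≠ 0) (hn : |m| * 2 ^ L < n) :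
    ∑ i ∈ Finset.range n, ‖doublingSum m L (((i : ℝ) / n : ℝ) : 𝕋)‖ ^ 2 = n * L := by
  have hn0 : n ≠ 0 := by
    rintro rfl
    exact absurd hn (not_lt.2 (by positivity))
  have hexpand (x : 𝕋) : ((‖doublingSum m L x‖ ^ 2 : ℝ) : ℂ) =
      ∑ j ∈ Finset.range L, ∑ l ∈ Finset.range L, fourier (m * (2 ^ j - 2 ^ l)) x := by
    rw [Complex.ofReal_pow, ← Complex.mul_conj', doublingSum, map_sum, Finset.sum_mul_sum]
    refine Finset.sum_congr rfl fun j _ => Finset.sum_congr rfl fun l _ => ?_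
    rw [fourier_nsmul, fourier_nsmul, ← fourier_neg, ← fourier_add]
    congr 2
    push_cast
    ring
  have hchar (j : ℕ) (hj : j ∈ Finset.range L) (l : ℕ) (hl : l ∈ Finset.range L) :
      ∑ i ∈ Finset.range n, fourier (m * (2 ^ j - 2 ^ l)) (((i : ℝ) / n : ℝ) : 𝕋) =
        if j = l then (n : ℂ) else 0 := by
    split_ifs with hjl
    · subst hjl
      simp
    · refine sum_fourier_div_eq_zero hn0 fun hdvd => ?_
      have hne : (2 : ℤ) ^ j - 2 ^ l ≠ 0 :=
        sub_ne_zero.2 fun h => hjl (Int.pow_right_injective (by norm_num) h)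
      have hjL : (2 : ℤ) ^ j ≤ 2 ^ L :=
        pow_le_pow_right₀ (by norm_num) (Finset.mem_range.1 hj).le
      have hlL : (2 : ℤ) ^ l ≤ 2 ^ L :=
        pow_le_pow_right₀ (by norm_num) (Finset.mem_range.1 hl).le
      have hj0 : (0 : ℤ) < 2 ^ j := by positivity
      have hl0 : (0 : ℤ) < 2 ^ l := by positivity
      refine mul_ne_zero hm hne (Int.eq_zero_of_abs_lt_dvd hdvd (lt_of_le_of_lt ?_ hn))
      rw [abs_mul]
      gcongr
      exact abs_le.2 ⟨by linarith, by linarith⟩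
  have hcomplex : ((∑ i ∈ Finset.range n, ‖doublingSum m L (((i : ℝ) / n : ℝ) : 𝕋)‖ ^ 2 : ℝ) : ℂ)
      = n * L := by
    rw [Complex.ofReal_sum]
    simp_rw [hexpand]
    rw [Finset.sum_comm]
    simp_rw [fun j : ℕ => Finset.sum_comm (s := Finset.range n) (t := Finset.range L)
      (f := fun i l => fourier (m * (2 ^ j - 2 ^ l)) (((i : ℝ) / n : ℝ) : 𝕋))]
    rw [Finset.sum_congr rfl fun j hj => Finset.sum_congr rfl (hchar j hj)]
    rw [Finset.sum_congr rfl fun j hj => by rw [Finset.sum_ite_eq, if_pos hj]]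
    simp [mul_comm]
  exact_mod_cast hcomplex

lemma sum_Fn_le_sum_range {n : ℕ} {B : Finset 𝕋} (hB : (B : Set 𝕋) ⊆ Fn n) {g : 𝕋 → ℝ}
    (hg : ∀ x, 0 ≤ g x) :
    ∑ x ∈ B, g x ≤ ∑ i ∈ Finset.range n, g (((i : ℝ) / n : ℝ) : 𝕋) := by
  classical
  calc ∑ x ∈ B, g x
      ≤ ∑ x ∈ (Finset.range n).image fun i : ℕ => (((i : ℝ) / n : ℝ) : 𝕋), g x := by
        refine Finset.sum_le_sum_of_subset_of_nonneg (fun x hx => ?_) fun x _ _ => hg x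
        obtain ⟨i, -, hi, rfl⟩ := hB hx
        exact Finset.mem_image_of_mem _ (Finset.mem_range.2 hi)
    _ ≤ _ := Finset.sum_image_le_of_nonneg fun i _ => hg _

/-- For any `δ > 0` and `ε > 0` there is `N` such that for every `n > N` coprime with `6`,
in any decomposition of `F_n` into pairwise disjoint minimal invariant sets, the union of
those sets whose normalized counting measure is at Lévy–Prokhorov distance at least `δ`
from the Haar measure has cardinality less than `ε·n`. -/
theorem few_outlier_orbits (δ ε : ℝ) (hδ : 0 < δ) (hε : 0 < ε) :
    ∃ N : ℕ, ∀ n : ℕ, N < n → Nat.gcd n 6 = 1 →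
      ∀ (k : ℕ) (O : Fin k → Set 𝕋),
        (∀ i, MinimalInvariant (O i)) →
        (Pairwise fun i j => Disjoint (O i) (O j)) →
        (⋃ i, O i) = Fn n →
        (((⋃ i ∈ {i : Fin k |
            δ ≤ levyProkhorovDist (normCount (O i)) (volume : Measure 𝕋)}, O i).ncard : ℝ))
          < ε * n := by
  classical
  obtain ⟨M, η, hη, hclose⟩ := exists_levyProkhorovDist_lt_of_norm_integral_fourier_lt hδ
  set freqs : Finset ℤ := (Finset.Icc (-(M : ℤ)) M).erase 0
  obtain ⟨L, hL⟩ := exists_nat_gt ((freqs.card : ℝ) / (ε * η ^ 2))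
  have hL0 : (0 : ℝ) < L := lt_of_le_of_lt (by positivity) hL
  refine ⟨M * 2 ^ L, fun n hn _ k O hmin hdisj hunion => ?_⟩
  have hn0 : (0 : ℝ) < n := by exact_mod_cast (Nat.zero_le _).trans_lt hn
  let s : Fin k → Finset 𝕋 := fun i => (hmin i).2.1.toFinset
  have hs (i : Fin k) : (s i : Set 𝕋) = O i := (hmin i).2.1.coe_toFinset
  let g : 𝕋 → ℝ := fun x => ∑ m ∈ freqs, ‖doublingSum m L x‖ ^ 2
  have hg (x : 𝕋) : 0 ≤ g x := Finset.sum_nonneg fun m _ => by positivity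
  let bad : Finset (Fin k) :=
    Finset.univ.filter fun i => δ ≤ levyProkhorovDist (normCount (O i)) volume
  have hbad (i : Fin k) (hi : i ∈ bad) : (s i).card * (L * η) ^ 2 ≤ ∑ x ∈ s i, g x := by
    have hprob := isProbabilityMeasure_normCount (hmin i).1 (hmin i).2.1
    obtain ⟨m, hm0, hmM, hm⟩ : ∃ m : ℤ, m ≠ 0 ∧ |m| ≤ M ∧
        η ≤ ‖∫ x, fourier m x ∂(normCount (O i))‖ := by
      by_contra! hsmall
      exact (hclose _ hprob hsmall).not_ge (Finset.mem_filter.1 hi).2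
    rw [← hs i] at hm
    refine (card_mul_le_sum_norm_doublingSum_sq (by rw [hs, (hmin i).image_T])
      (by rw [← Finset.coe_nonempty, hs]; exact (hmin i).1) m L hη.le hm).trans ?_
    refine Finset.sum_le_sum fun x _ => ?_
    exact Finset.single_le_sum (f := fun m => ‖doublingSum m L x‖ ^ 2)
      (fun _ _ => by positivity)
      (Finset.mem_erase.2 ⟨hm0, Finset.mem_Icc.2 (abs_le.1 hmM)⟩)
  have hsdisj : (bad : Set (Fin k)).PairwiseDisjoint s := fun i _ j _ hij => by
    simpa only [Function.onFun, ← Finset.disjoint_coe, hs] using hdisj hij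
  have hcoe : (⋃ i ∈ {i : Fin k | δ ≤ levyProkhorovDist (normCount (O i))
      (volume : Measure 𝕋)}, O i) = (bad.biUnion s : Set 𝕋) := by
    simp [bad, hs]
  have hsub : ((bad.biUnion s : Finset 𝕋) : Set 𝕋) ⊆ Fn n := by
    rw [← hcoe, ← hunion]
    exact Set.iUnion₂_subset_iUnion _ _
  rw [hcoe, Set.ncard_coe_finset]
  have htotal : (bad.biUnion s).card * (L * η) ^ 2 ≤ freqs.card * (n * L : ℝ) := by
    calc ((bad.biUnion s).card : ℝ) * (L * η) ^ 2
        = ∑ i ∈ bad, (s i).card * (L * η) ^ 2 := by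
          rw [Finset.card_biUnion hsdisj, Nat.cast_sum, Finset.sum_mul]
      _ ≤ ∑ i ∈ bad, ∑ x ∈ s i, g x := Finset.sum_le_sum hbad
      _ = ∑ x ∈ bad.biUnion s, g x := (Finset.sum_biUnion hsdisj).symm
      _ ≤ ∑ i ∈ Finset.range n, g (((i : ℝ) / n : ℝ) : 𝕋) := sum_Fn_le_sum_range hsub hg
      _ = ∑ m ∈ freqs, (n * L : ℝ) := by
          rw [Finset.sum_comm]
          refine Finset.sum_congr rfl fun m hm => sum_norm_doublingSum_sq
            (Finset.ne_of_mem_erase hm) (lt_of_le_of_lt ?_ (Nat.cast_lt (α := ℤ).2 hn))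
          push_cast
          gcongr
          exact abs_le.2 (Finset.mem_Icc.1 (Finset.mem_of_mem_erase hm))
      _ = _ := by rw [Finset.sum_const, nsmul_eq_mul]
  rw [div_lt_iff₀ (by positivity)] at hL
  have hstrict : freqs.card * (n * L : ℝ) < ε * n * (L * η) ^ 2 := by
    calc freqs.card * (n * L : ℝ) < L * (ε * η ^ 2) * (n * L) := by gcongr
      _ = _ := by ring
  exact lt_of_mul_lt_mul_right (htotal.trans_lt hstrict) (by positivity)
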